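/- Let d ∈ ℕ, δ > 0, and let S ⊆ ℝ^d be a set with ‖w‖_∞ ≤ δ for all w ∈ S. Define T : ℝ^d → Δ_d by mapping w = (w₁,…,w_d) to the polygonal curve with vertex sequence (w₁ + 6δ, w₂ − 6δ, w₃ + 6δ, …, w_d + (−1)^{d+1}·6δ) (the i-th coordinate translated by +6δ if i is odd and by −6δ if i is even). Then for all w, x ∈ S, d_F(T(w), T(x)) = ‖w − x‖_∞; in particular, T is an isometric embedding of (S, ℓ_∞) into the set Δ_d of polygonal curves with at most d vertices equipped with the Fréchet distance. -/

import Mathlib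

open Set

/-- A valid reparametrization of `[0,1]`: a continuous strictly increasing
bijection of `[0,1]` onto itself fixing the endpoints. -/
def IsReparam (f : ℝ → ℝ) : Prop :=
  ContinuousOn f (Set.Icc 0 1) ∧ StrictMonoOn f (Set.Icc 0 1) ∧ f 0 = 0 ∧ f 1 = 1

/-- The Fréchet distance between two curves `τ, π : [0,1] → ℝ`:
`inf_f sup_{t ∈ [0,1]} |τ(f(t)) - π(t)|` over reparametrizations `f`. -/
noncomputable def frechetDist (τ π : ℝ → ℝ) : ℝ :=
  ⨅ f : {f : ℝ → ℝ // IsReparam f}, ⨆ t : Set.Icc (0:ℝ) 1, |τ (f.1 ↑t) - π ↑t|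

/-- `τ` is the polygonal curve on `[0,1]` with the `m` vertices `w 0, …, w (m-1)`
attained at parameters `t 0 = 0 < t 1 < … < t (m-1) = 1`, obtained by linear
interpolation. -/
def IsPolyOn (τ : ℝ → ℝ) (m : ℕ) (t w : ℕ → ℝ) : Prop :=
  2 ≤ m ∧ t 0 = 0 ∧ t (m - 1) = 1 ∧ (∀ i, i + 1 < m → t i < t (i + 1)) ∧
  (∀ i, i + 1 < m → ∀ u ∈ Set.Icc (t i) (t (i + 1)),
    τ u = w i + (u - t i) / (t (i + 1) - t i) * (w (i + 1) - w i))

/-- `τ` is a polygonal curve (with finitely many vertices). -/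
def IsPolyCurve (τ : ℝ → ℝ) : Prop := ∃ m t w, IsPolyOn τ m t w

/-- `c` is a polygonal curve with at most `ℓ` vertices, i.e. an element of `Δ_ℓ`. -/
def InDeltaL (ℓ : ℕ) (c : ℝ → ℝ) : Prop := ∃ m t w, m ≤ ℓ ∧ IsPolyOn c m t w

/-- General position of the vertex sequence `w 0, …, w (m-1)`: pairwise distinct
vertex values, pairwise distinct differences, and no vertex inside the closed
interval spanned by its two neighbours. -/
def GenPos (m : ℕ) (w : ℕ → ℝ) : Prop :=
  (∀ i j, i < m → j < m → i ≠ j → w i ≠ w j) ∧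
  (∀ i j p q, i < m → j < m → p < m → q < m → i ≠ j → p ≠ q →
      (i, j) ≠ (p, q) → w i - w j ≠ w p - w q) ∧
  (∀ i, i + 2 < m → w (i + 1) ∉ Set.uIcc (w i) (w (i + 2)))

/-- The parameters `s 0 = 0 < s 1 < … < s (ℓ-1) = 1` define a `δ`-signature of the
curve `τ` (Definition 3.3 of the paper, `0`-indexed): non-degeneracy,
direction-preservation, minimum edge length and range conditions. -/
def IsSignature (δ : ℝ) (τ : ℝ → ℝ) (ℓ : ℕ) (s : ℕ → ℝ) : Prop :=
  2 ≤ ℓ ∧ s 0 = 0 ∧ s (ℓ - 1) = 1 ∧ (∀ i, i + 1 < ℓ → s i < s (i + 1)) ∧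
  (∀ i, 1 ≤ i → i + 1 < ℓ → τ (s i) ∉ Set.uIcc (τ (s (i - 1))) (τ (s (i + 1)))) ∧
  (∀ i, i + 1 < ℓ → ∀ a b : ℝ, s i ≤ a → a < b → b ≤ s (i + 1) →
      (τ (s i) < τ (s (i + 1)) → τ a - τ b ≤ 2 * δ) ∧
      (τ (s (i + 1)) < τ (s i) → τ b - τ a ≤ 2 * δ)) ∧
  (∀ i, 1 ≤ i → i + 3 ≤ ℓ → 2 * δ < |τ (s (i + 1)) - τ (s i)|) ∧
  δ < |τ (s 1) - τ (s 0)| ∧ δ < |τ (s (ℓ - 1)) - τ (s (ℓ - 2))| ∧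
  (∀ i, 1 ≤ i → i + 3 ≤ ℓ → ∀ a ∈ Set.Icc (s i) (s (i + 1)),
      τ a ∈ Set.uIcc (τ (s i)) (τ (s (i + 1)))) ∧
  (2 < ℓ → ∀ a ∈ Set.Icc (s 0) (s 1),
      τ a ∈ Set.uIcc (τ (s 0)) (τ (s 1)) ∪ Set.Icc (τ (s 0) - δ) (τ (s 0) + δ)) ∧
  (2 < ℓ → ∀ a ∈ Set.Icc (s (ℓ - 2)) (s (ℓ - 1)),
      τ a ∈ Set.uIcc (τ (s (ℓ - 2))) (τ (s (ℓ - 1))) ∪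
        Set.Icc (τ (s (ℓ - 1)) - δ) (τ (s (ℓ - 1)) + δ)) ∧
  (ℓ = 2 → ∀ a ∈ Set.Icc (s 0) (s 1),
      τ a ∈ Set.uIcc (τ (s 0)) (τ (s 1)) ∪ Set.Icc (τ (s 0) - δ) (τ (s 0) + δ) ∪
        Set.Icc (τ (s 1) - δ) (τ (s 1) + δ))

/-- The translated vertex sequence of the embedding `T`: the `i`-th coordinate of
`y : ℝ^d` translated by `+6δ` for even `i` and `-6δ` for odd `i` (0-indexed, i.e.
odd coordinates get `+6δ`, even coordinates get `-6δ` in 1-indexed notation). -/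
noncomputable def embVertices (d : ℕ) (δ : ℝ) (y : Fin d → ℝ) : ℕ → ℝ :=
  fun i => (if h : i < d then y ⟨i, h⟩ else 0) + (if i % 2 = 0 then 6 * δ else -(6 * δ))

/-- A point of `[t 0, t n)` lies in one of the half-open intervals `[t i, t (i + 1))`. -/
theorem exists_mem_Ico_succ (t : ℕ → ℝ) (u : ℝ) (n : ℕ) (h0 : t 0 ≤ u) (hn : u < t n) :
    ∃ i < n, u ∈ Ico (t i) (t (i + 1)) := by
  induction n with
  | zero => exact absurd h0 (not_le.2 hn)
  | succ n ih =>
    rcases lt_or_ge u (t n) with h | h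
    · obtain ⟨i, hi, hu⟩ := ih h
      exact ⟨i, by omega, hu⟩
    · exact ⟨n, by omega, h, hn⟩

theorem exists_mem_Icc_succ (t : ℕ → ℝ) (u : ℝ) (n : ℕ) (hpos : 0 < n)
    (ht : ∀ i, i < n → t i < t (i + 1)) (h0 : t 0 ≤ u) (hn : u ≤ t n) :
    ∃ i < n, u ∈ Icc (t i) (t (i + 1)) := by
  rcases hn.lt_or_eq with h | rfl
  · obtain ⟨i, hi, hu⟩ := exists_mem_Ico_succ t u n h0 h
    exact ⟨i, hi, hu.1, hu.2.le⟩
  · obtain ⟨m, rfl⟩ : ∃ m, n = m + 1 := ⟨n - 1, by omega⟩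
    exact ⟨m, by omega, (ht m (by omega)).le, le_rfl⟩

theorem le_of_forall_lt_succ {t : ℕ → ℝ} {n : ℕ} (ht : ∀ i, i < n → t i < t (i + 1))
    {i j : ℕ} (hij : i ≤ j) (hj : j ≤ n) : t i ≤ t j := by
  induction j, hij using Nat.le_induction with
  | base => exact le_rfl
  | succ j _ ih => exact (ih (by omega)).trans (ht j (by omega)).le

namespace IsPolyOn

variable {τ : ℝ → ℝ} {m : ℕ} {t v : ℕ → ℝ}

theorem mem_Icc (h : IsPolyOn τ m t v) {i : ℕ} (hi : i < m) : t i ∈ Icc (0 : ℝ) 1 := by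
  obtain ⟨_, h0, h1, ht, _⟩ := h
  have ht' : ∀ i, i < m - 1 → t i < t (i + 1) := fun i hi => ht i (by omega)
  rw [← h0, ← h1]
  exact ⟨le_of_forall_lt_succ ht' (Nat.zero_le i) (by omega),
    le_of_forall_lt_succ ht' (by omega) le_rfl⟩

theorem exists_edge (h : IsPolyOn τ m t v) {u : ℝ} (hu : u ∈ Icc (0 : ℝ) 1) :
    ∃ i, i + 1 < m ∧ u ∈ Icc (t i) (t (i + 1)) := by
  obtain ⟨hm, h0, h1, ht, _⟩ := h
  obtain ⟨i, hi, hui⟩ := exists_mem_Icc_succ t u (m - 1) (by omega)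
    (fun i hi => ht i (by omega)) (h0 ▸ hu.1) (h1 ▸ hu.2)
  exact ⟨i, by omega, hui⟩

/-- On an edge, the curve is a convex combination of the end vertices. -/
theorem exists_ratio (h : IsPolyOn τ m t v) {i : ℕ} (hi : i + 1 < m) {u : ℝ}
    (hu : u ∈ Icc (t i) (t (i + 1))) :
    ∃ r ∈ Icc (0 : ℝ) 1, τ u = v i + r * (v (i + 1) - v i) := by
  have hlt := sub_pos.2 (h.2.2.2.1 i hi)
  exact ⟨_, ⟨div_nonneg (sub_nonneg.2 hu.1) hlt.le,
    (div_le_one hlt).2 (sub_le_sub_right hu.2 _)⟩, h.2.2.2.2 i hi u hu⟩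

theorem apply_left (h : IsPolyOn τ m t v) {i : ℕ} (hi : i + 1 < m) : τ (t i) = v i := by
  rw [h.2.2.2.2 i hi _ ⟨le_rfl, (h.2.2.2.1 i hi).le⟩]
  simp

theorem apply_right (h : IsPolyOn τ m t v) {i : ℕ} (hi : i + 1 < m) :
    τ (t (i + 1)) = v (i + 1) := by
  have hlt := h.2.2.2.1 i hi
  rw [h.2.2.2.2 i hi _ ⟨hlt.le, le_rfl⟩, div_self (sub_pos.2 hlt).ne']
  ring

theorem apply_vertex (h : IsPolyOn τ m t v) {i : ℕ} (hi : i < m) : τ (t i) = v i := by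
  have hm := h.1
  rcases Nat.eq_zero_or_pos i with rfl | hpos
  · exact h.apply_left (by omega)
  · obtain ⟨j, rfl⟩ : ∃ j, i = j + 1 := ⟨i - 1, by omega⟩
    exact h.apply_right hi

theorem mul_le_mul_of_edge (h : IsPolyOn τ m t v) {i : ℕ} (hi : i + 1 < m) {c a b : ℝ}
    (hc : c * v i ≤ c * v (i + 1)) (ha : t i ≤ a) (hab : a ≤ b) (hb : b ≤ t (i + 1)) :
    c * τ a ≤ c * τ b := by
  have hlt := sub_pos.2 (h.2.2.2.1 i hi)
  rw [h.2.2.2.2 i hi a ⟨ha, hab.trans hb⟩, h.2.2.2.2 i hi b ⟨ha.trans hab, hb⟩]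
  have hr : (a - t i) / (t (i + 1) - t i) ≤ (b - t i) / (t (i + 1) - t i) := by gcongr
  nlinarith [mul_le_mul_of_nonneg_right hr (sub_nonneg.2 hc)]

theorem mul_le_of_edge (h : IsPolyOn τ m t v) {i : ℕ} (hi : i + 1 < m) {c B u : ℝ}
    (h0 : c * v i ≤ B) (h1 : c * v (i + 1) ≤ B) (hu : u ∈ Icc (t i) (t (i + 1))) :
    c * τ u ≤ B := by
  obtain ⟨r, hr, hτ⟩ := h.exists_ratio hi hu
  rw [hτ]
  nlinarith [mul_le_mul_of_nonneg_left h1 hr.1,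
    mul_le_mul_of_nonneg_left h0 (sub_nonneg.2 hr.2)]

theorem abs_le_of_vertices (h : IsPolyOn τ m t v) {B : ℝ} (hB : ∀ i < m, |v i| ≤ B) {u : ℝ}
    (hu : u ∈ Icc (0 : ℝ) 1) : |τ u| ≤ B := by
  obtain ⟨i, hi, hui⟩ := h.exists_edge hu
  have h0 := abs_le.1 (hB i (by omega))
  have h1 := abs_le.1 (hB (i + 1) hi)
  have hp := h.mul_le_of_edge hi (c := 1) (B := B) (by linarith) (by linarith) hui
  have hq := h.mul_le_of_edge hi (c := -1) (B := B) (by linarith) (by linarith) hui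
  exact abs_le.2 ⟨by linarith, by linarith⟩

/-- Between two curves with strongly alternating vertices, a monotone matching of small cost
sends each vertex beyond the preceding vertex of the other curve. -/
theorem vertex_lt_map_vertex_succ {σ : ℝ → ℝ} {s y : ℕ → ℝ} {δ : ℝ}
    (h : IsPolyOn τ m t v) (h' : IsPolyOn σ m s y)
    (hv : ∀ i < m, 5 * δ ≤ (-1) ^ i * v i) (hy : ∀ i < m, 5 * δ ≤ (-1) ^ i * y i)
    {f : ℝ → ℝ} (hf : StrictMonoOn f (Icc 0 1)) (hf0 : f 0 = 0)
    (hcost : ∀ u ∈ Icc (0 : ℝ) 1, |τ (f u) - σ u| < 2 * δ)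
    (j : ℕ) (hj : j + 1 < m) : t j < f (s (j + 1)) := by
  have hlt : ∀ i, i + 1 < m → f (s i) < f (s (i + 1)) := fun i hi =>
    hf (h'.mem_Icc (by omega)) (h'.mem_Icc hi) (h'.2.2.2.1 i hi)
  induction j with
  | zero =>
    have := hlt 0 hj
    rwa [h'.2.1, hf0, ← h.2.1] at this
  | succ j ih =>
    have hprev := ih (by omega)
    by_contra! hle
    have hδ : 0 < δ := by
      linarith [abs_nonneg (τ (f (s j)) - σ (s j)), hcost (s j) (h'.mem_Icc (by omega))]
    have hv0 := hv j (by omega)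
    have hv1 := hv (j + 1) (by omega)
    have hy1 := hy (j + 1) (by omega)
    have hy2 := hy (j + 2) (by omega)
    have hc1 := hcost (s (j + 1)) (h'.mem_Icc (by omega))
    have hc2 := hcost (s (j + 2)) (h'.mem_Icc (by omega))
    rw [h'.apply_vertex (by omega)] at hc1 hc2
    have hmono := h.mul_le_mul_of_edge (i := j) (c := (-1) ^ (j + 1)) (by omega)
      (by rw [pow_succ] at hv1 ⊢; linarith) hprev.le (hlt (j + 1) hj).le hle
    rw [abs_lt] at hc1 hc2
    simp only [pow_succ] at hv0 hv1 hy1 hy2 hmono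
    rcases neg_one_pow_eq_or ℝ j with hs | hs <;> rw [hs] at hv0 hv1 hy1 hy2 hmono <;> linarith

/-- On the two edges incident to the `i`-th vertex of a curve with strongly alternating vertices,
that vertex is extremal. -/
theorem mul_apply_le_mul_vertex {δ : ℝ} (hδ : 0 < δ) (h : IsPolyOn τ m t v)
    (hv : ∀ i < m, 5 * δ ≤ (-1) ^ i * v i) {i : ℕ} (hi : i < m) {u : ℝ}
    (hu : u ∈ Icc (0 : ℝ) 1) (hl : ∀ j, j + 1 = i → t j < u) (hr : i + 1 < m → u < t (i + 1)) :
    (-1) ^ i * τ u ≤ (-1) ^ i * v i := by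
  have hm := h.1
  have hvi := hv i hi
  rcases le_or_gt (t i) u with hiu | hiu
  · by_cases hi1 : i + 1 < m
    · refine h.mul_le_of_edge hi1 le_rfl ?_ ⟨hiu, (hr hi1).le⟩
      have := hv (i + 1) hi1
      rw [pow_succ] at this
      linarith
    · obtain rfl : i = m - 1 := by omega
      have : u = t (m - 1) := le_antisymm (h.2.2.1 ▸ hu.2) hiu
      rw [this, h.apply_vertex hi]
  · rcases Nat.eq_zero_or_pos i with rfl | hpos
    · exact absurd hu.1 (not_le.2 (h.2.1 ▸ hiu))
    · obtain ⟨j, rfl⟩ : ∃ j, i = j + 1 := ⟨i - 1, by omega⟩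
      refine h.mul_le_of_edge hi ?_ le_rfl ⟨(hl j rfl).le, hiu.le⟩
      have := hv j (by omega)
      rw [pow_succ] at hvi ⊢
      linarith

end IsPolyOn

namespace IsReparam

variable {f : ℝ → ℝ}

theorem mapsTo (hf : IsReparam f) : MapsTo f (Icc 0 1) (Icc 0 1) := fun _ hu =>
  ⟨hf.2.2.1 ▸ hf.2.1.monotoneOn ⟨le_rfl, zero_le_one⟩ hu hu.1,
    hf.2.2.2 ▸ hf.2.1.monotoneOn hu ⟨zero_le_one, le_rfl⟩ hu.2⟩

theorem exists_rightInverse (hf : IsReparam f) :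
    ∃ g : ℝ → ℝ, StrictMonoOn g (Icc 0 1) ∧ g 0 = 0 ∧
      (∀ u ∈ Icc (0 : ℝ) 1, g u ∈ Icc (0 : ℝ) 1 ∧ f (g u) = u) := by
  have hsurj : ∀ u ∈ Icc (0 : ℝ) 1, ∃ a ∈ Icc (0 : ℝ) 1, f a = u := fun u hu => by
    have := intermediate_value_Icc zero_le_one hf.1
    rw [hf.2.2.1, hf.2.2.2] at this
    exact this hu
  choose! g hg hfg using hsurj
  refine ⟨g, fun a ha b hb hab => ?_, ?_, fun u hu => ⟨hg u hu, hfg u hu⟩⟩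
  · rwa [← hf.2.1.lt_iff_lt (hg a ha) (hg b hb), hfg a ha, hfg b hb]
  · have h0 : (0 : ℝ) ∈ Icc (0 : ℝ) 1 := ⟨le_rfl, zero_le_one⟩
    exact hf.2.1.injOn (hg 0 h0) h0 ((hfg 0 h0).trans hf.2.2.1.symm)

end IsReparam

/-- The piecewise linear map sending `s i` to `t i` for `i ≤ n` (when `t 0 = 0`). -/
noncomputable def piecewiseLinear (n : ℕ) (s t : ℕ → ℝ) (u : ℝ) : ℝ :=
  ∑ i ∈ Finset.range n, (t (i + 1) - t i) * max 0 (min 1 ((u - s i) / (s (i + 1) - s i)))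

theorem piecewiseLinear_eq {n : ℕ} {s t : ℕ → ℝ} (hs : ∀ i, i < n → s i < s (i + 1))
    (ht0 : t 0 = 0) {k : ℕ} (hk : k < n) {u : ℝ} (hu : u ∈ Icc (s k) (s (k + 1))) :
    piecewiseLinear n s t u = t k + (u - s k) / (s (k + 1) - s k) * (t (k + 1) - t k) := by
  have hlow : ∀ i ∈ Finset.range k, (t (i + 1) - t i) *
      max 0 (min 1 ((u - s i) / (s (i + 1) - s i))) = t (i + 1) - t i := fun i hi => by
    have hik := Finset.mem_range.1 hi
    have hle : s (i + 1) ≤ s k := le_of_forall_lt_succ hs hik hk.le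
    have : 1 ≤ (u - s i) / (s (i + 1) - s i) :=
      (one_le_div (sub_pos.2 (hs i (by omega)))).2 (by linarith [hu.1])
    rw [min_eq_left this, max_eq_right zero_le_one, mul_one]
  have hhigh : ∀ i ∈ Finset.Ico (k + 1) n, (t (i + 1) - t i) *
      max 0 (min 1 ((u - s i) / (s (i + 1) - s i))) = 0 := fun i hi => by
    obtain ⟨hki, hin⟩ := Finset.mem_Ico.1 hi
    have hle : s (k + 1) ≤ s i := le_of_forall_lt_succ hs hki hin.le
    have : (u - s i) / (s (i + 1) - s i) ≤ 0 :=
      div_nonpos_of_nonpos_of_nonneg (by linarith [hu.2]) (sub_pos.2 (hs i hin)).le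
    rw [max_eq_left ((min_le_right _ _).trans this), mul_zero]
  have hlt := sub_pos.2 (hs k hk)
  have hr0 : 0 ≤ (u - s k) / (s (k + 1) - s k) := div_nonneg (sub_nonneg.2 hu.1) hlt.le
  have hr1 : (u - s k) / (s (k + 1) - s k) ≤ 1 :=
    (div_le_one hlt).2 (sub_le_sub_right hu.2 _)
  rw [piecewiseLinear, ← Finset.sum_range_add_sum_Ico _ (show k + 1 ≤ n from hk),
    Finset.sum_range_succ, Finset.sum_congr rfl hlow, Finset.sum_eq_zero hhigh,
    Finset.sum_range_sub, ht0, min_eq_right hr1, max_eq_right hr0]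
  ring

theorem isReparam_piecewiseLinear {n : ℕ} {s t : ℕ → ℝ} (hn : 0 < n)
    (hs : ∀ i, i < n → s i < s (i + 1)) (ht : ∀ i, i < n → t i < t (i + 1))
    (hs0 : s 0 = 0) (ht0 : t 0 = 0) (hs1 : s n = 1) (ht1 : t n = 1) :
    IsReparam (piecewiseLinear n s t) := by
  have hterm : ∀ i, i < n → ∀ a b : ℝ, a ≤ b →
      max 0 (min 1 ((a - s i) / (s (i + 1) - s i))) ≤
        max 0 (min 1 ((b - s i) / (s (i + 1) - s i))) := fun i hi a b hab => by
    have := sub_pos.2 (hs i hi)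
    gcongr
  refine ⟨?_, fun a ha b hb hab => ?_, ?_, ?_⟩
  · unfold piecewiseLinear
    fun_prop
  · obtain ⟨k, hk, hak⟩ := exists_mem_Ico_succ s a n (hs0 ▸ ha.1) (hs1 ▸ hab.trans_le hb.2)
    refine Finset.sum_lt_sum (fun i hi => ?_) ⟨k, Finset.mem_range.2 hk, ?_⟩
    · have hi := Finset.mem_range.1 hi
      exact mul_le_mul_of_nonneg_left (hterm i hi a b hab.le) (sub_pos.2 (ht i hi)).le
    · refine mul_lt_mul_of_pos_left ?_ (sub_pos.2 (ht k hk))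
      have hlt := sub_pos.2 (hs k hk)
      have h0 : 0 ≤ (a - s k) / (s (k + 1) - s k) := div_nonneg (sub_nonneg.2 hak.1) hlt.le
      have h1 : (a - s k) / (s (k + 1) - s k) < 1 :=
        (div_lt_one hlt).2 (sub_lt_sub_right hak.2 _)
      have hr : (a - s k) / (s (k + 1) - s k) < (b - s k) / (s (k + 1) - s k) := by gcongr
      rw [min_eq_right h1.le, max_eq_right h0]
      exact lt_max_of_lt_right (lt_min h1 hr)
  · rw [piecewiseLinear_eq hs ht0 hn (hs0 ▸ ⟨le_rfl, (hs 0 hn).le⟩), ht0, hs0]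
    simp
  · obtain ⟨m, rfl⟩ : ∃ m, n = m + 1 := ⟨n - 1, by omega⟩
    have hlt := hs m (by omega)
    rw [piecewiseLinear_eq hs ht0 (Nat.lt_succ_self m) (hs1 ▸ ⟨hlt.le, le_rfl⟩), ← hs1,
      div_self (sub_pos.2 hlt).ne', hs1, ht1]
    ring

/-- Two polygonal curves with the same number of vertices admit a reparametrization whose cost is
bounded by the largest distance between corresponding vertices. -/
theorem IsPolyOn.exists_reparam {τ σ : ℝ → ℝ} {m : ℕ} {t s v y : ℕ → ℝ} (h : IsPolyOn τ m t v)
    (h' : IsPolyOn σ m s y) {e : ℝ} (he : ∀ i < m, |v i - y i| ≤ e) :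
    ∃ f, IsReparam f ∧ ∀ u ∈ Icc (0 : ℝ) 1, |τ (f u) - σ u| ≤ e := by
  have hm := h.1
  have hs : ∀ i, i < m - 1 → s i < s (i + 1) := fun i hi => h'.2.2.2.1 i (by omega)
  have ht : ∀ i, i < m - 1 → t i < t (i + 1) := fun i hi => h.2.2.2.1 i (by omega)
  refine ⟨piecewiseLinear (m - 1) s t, isReparam_piecewiseLinear (by omega) hs ht h'.2.1 h.2.1
    h'.2.2.1 h.2.2.1, fun u hu => ?_⟩
  obtain ⟨k, hk, huk⟩ := h'.exists_edge hu
  have hsk := sub_pos.2 (hs k (by omega))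
  have htk := sub_pos.2 (ht k (by omega))
  rw [piecewiseLinear_eq hs h.2.1 (by omega) huk, h'.2.2.2.2 k hk u huk]
  have hr0 : 0 ≤ (u - s k) / (s (k + 1) - s k) := div_nonneg (sub_nonneg.2 huk.1) hsk.le
  have hr1 : (u - s k) / (s (k + 1) - s k) ≤ 1 :=
    (div_le_one hsk).2 (sub_le_sub_right huk.2 _)
  generalize (u - s k) / (s (k + 1) - s k) = r at hr0 hr1
  rw [h.2.2.2.2 k hk _ ⟨by nlinarith, by nlinarith⟩, add_sub_cancel_left,
    mul_div_cancel_right₀ _ htk.ne']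
  have h0 := abs_le.1 (he k (by omega))
  have h1 := abs_le.1 (he (k + 1) hk)
  have hr1' := sub_nonneg.2 hr1
  rw [abs_le]
  constructor
  · nlinarith [mul_le_mul_of_nonneg_left h0.1 hr1', mul_le_mul_of_nonneg_left h1.1 hr0]
  · nlinarith [mul_le_mul_of_nonneg_left h0.2 hr1', mul_le_mul_of_nonneg_left h1.2 hr0]

/-- For curves with strongly alternating vertices, a matching of small cost matches corresponding
vertices up to that cost. -/
theorem IsPolyOn.abs_vertex_sub_le {τ σ : ℝ → ℝ} {m : ℕ} {t s v y : ℕ → ℝ} {δ C : ℝ}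
    (h : IsPolyOn τ m t v) (h' : IsPolyOn σ m s y)
    (hv : ∀ i < m, 5 * δ ≤ (-1) ^ i * v i) (hy : ∀ i < m, 5 * δ ≤ (-1) ^ i * y i)
    {f : ℝ → ℝ} (hf : IsReparam f) (hC : C < 2 * δ)
    (hcost : ∀ u ∈ Icc (0 : ℝ) 1, |τ (f u) - σ u| ≤ C) {i : ℕ} (hi : i < m) :
    |v i - y i| ≤ C := by
  obtain ⟨g, hgmono, hg0, hg⟩ := hf.exists_rightInverse
  have hcost' : ∀ u ∈ Icc (0 : ℝ) 1, |σ (g u) - τ u| ≤ C := fun u hu => by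
    have := hcost (g u) (hg u hu).1
    rwa [(hg u hu).2, abs_sub_comm] at this
  have hδ : 0 < δ := by
    linarith [abs_nonneg (τ (f (s i)) - σ (s i)), hcost (s i) (h'.mem_Icc hi)]
  have hforw := h.vertex_lt_map_vertex_succ h' hv hy hf.2.1 hf.2.2.1
    fun u hu => (hcost u hu).trans_lt hC
  have hback := h'.vertex_lt_map_vertex_succ h hy hv hgmono hg0
    fun u hu => (hcost' u hu).trans_lt hC
  have hsi := h'.mem_Icc hi
  have hti := h.mem_Icc hi
  have hτ := h.mul_apply_le_mul_vertex hδ hv hi (hf.mapsTo hsi)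
    (fun j hj => by subst hj; exact hforw j hi) fun hi1 => by
      have := h.mem_Icc hi1
      have hlt := hf.2.1 hsi (hg _ this).1 (hback i hi1)
      rwa [(hg _ this).2] at hlt
  have hσ := h'.mul_apply_le_mul_vertex hδ hy hi (hg _ hti).1
    (fun j hj => by subst hj; exact hback j hi) fun hi1 => by
      have hsi1 := h'.mem_Icc hi1
      rw [← hf.2.1.lt_iff_lt (hg _ hti).1 hsi1, (hg _ hti).2]
      exact hforw i hi1
  have hc := hcost _ hsi
  have hc' := hcost' _ hti
  rw [h'.apply_vertex hi] at hc
  rw [h.apply_vertex hi] at hc'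
  rw [abs_le] at hc hc' ⊢
  rcases neg_one_pow_eq_or ℝ i with hs | hs <;> rw [hs] at hτ hσ <;> constructor <;> linarith

theorem embVertices_eq {d : ℕ} (δ : ℝ) (y : Fin d → ℝ) {i : ℕ} (hi : i < d) :
    embVertices d δ y i = y ⟨i, hi⟩ + (-1) ^ i * (6 * δ) := by
  rw [embVertices, dif_pos hi]
  split_ifs with h
  · rw [(Nat.even_iff.2 h).neg_one_pow, one_mul]
  · rw [(Nat.not_even_iff_odd.1 (mt Nat.even_iff.1 h)).neg_one_pow, neg_one_mul]

theorem embVertices_bounds {d : ℕ} {δ : ℝ} {y : Fin d → ℝ} (hy : ‖y‖ ≤ δ) {i : ℕ} (hi : i < d) :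
    5 * δ ≤ (-1) ^ i * embVertices d δ y i ∧ |embVertices d δ y i| ≤ 7 * δ := by
  have hyi := abs_le.1 ((norm_le_pi_norm y ⟨i, hi⟩).trans hy)
  rw [embVertices_eq δ y hi, abs_le]
  rcases neg_one_pow_eq_or ℝ i with hs | hs <;> rw [hs] <;>
    refine ⟨?_, ?_, ?_⟩ <;> linarith

/-- Lemma 7.1: for any bounded `S ⊆ (ℝ^d, ℓ_∞)` with
`‖y‖_∞ ≤ δ` for all `y ∈ S`, the map `T` sending `y` to the polygonal curve with
vertex sequence `embVertices d δ y` is an isometric embedding of `(S, ℓ_∞)` into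
`Δ_d` with the Fréchet distance: `d_F(T w, T x) = ‖w - x‖_∞`. -/
theorem frechet_embedding_isometric (d : ℕ) (hd : 2 ≤ d) (δ : ℝ) (hδ : 0 < δ)
    (S : Set (Fin d → ℝ)) (hS : ∀ y ∈ S, ‖y‖ ≤ δ)
    (w x : Fin d → ℝ) (hw : w ∈ S) (hx : x ∈ S)
    (Tw Tx : ℝ → ℝ) (tw tx : ℕ → ℝ)
    (hTw : IsPolyOn Tw d tw (embVertices d δ w))
    (hTx : IsPolyOn Tx d tx (embVertices d δ x)) :
    frechetDist Tw Tx = ‖w - x‖ := by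

  have hbw := fun i (hi : i < d) => embVertices_bounds (hS w hw) hi
  have hbx := fun i (hi : i < d) => embVertices_bounds (hS x hx) hi
  have hsub : ∀ i (hi : i < d),
      embVertices d δ w i - embVertices d δ x i = (w - x) ⟨i, hi⟩ := fun i hi => by
    rw [embVertices_eq δ w hi, embVertices_eq δ x hi, Pi.sub_apply]
    ring
  have hbdd : ∀ f, IsReparam f →
      BddAbove (range fun t : Icc (0 : ℝ) 1 => |Tw (f t) - Tx t|) := by
    intro f hf
    refine ⟨7 * δ + 7 * δ, ?_⟩
    rintro _ ⟨t, rfl⟩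
    exact (abs_sub _ _).trans (add_le_add
      (hTw.abs_le_of_vertices (fun i hi => (hbw i hi).2) (hf.mapsTo t.2))
      (hTx.abs_le_of_vertices (fun i hi => (hbx i hi).2) t.2))
  obtain ⟨f₀, hf₀, hcost⟩ := hTw.exists_reparam hTx (e := ‖w - x‖) fun i hi => by
    rw [hsub i hi]
    exact norm_le_pi_norm (w - x) ⟨i, hi⟩
  have : Nonempty (Icc (0 : ℝ) 1) := ⟨0, le_rfl, zero_le_one⟩
  have : Nonempty {f : ℝ → ℝ // IsReparam f} := ⟨f₀, hf₀⟩
  refine le_antisymm ?_ (le_ciInf fun f => ?_)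
  · refine (ciInf_le ⟨0, ?_⟩ (⟨f₀, hf₀⟩ : {f : ℝ → ℝ // IsReparam f})).trans
      (ciSup_le fun t => hcost t t.2)
    rintro _ ⟨f, rfl⟩
    exact Real.iSup_nonneg fun t => abs_nonneg _
  · have hle : ∀ u ∈ Icc (0 : ℝ) 1, |Tw (f.1 u) - Tx u| ≤
        ⨆ t : Icc (0 : ℝ) 1, |Tw (f.1 t) - Tx t| := fun u hu =>
      le_ciSup (hbdd f.1 f.2) (⟨u, hu⟩ : Icc (0 : ℝ) 1)
    rcases le_or_gt (2 * δ) (⨆ t : Icc (0 : ℝ) 1, |Tw (f.1 t) - Tx t|) with hC | hC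
    · linarith [norm_sub_le w x, hS w hw, hS x hx]
    · refine (pi_norm_le_iff_of_nonneg (Real.iSup_nonneg fun t => abs_nonneg _)).2 fun i => ?_
      rw [Real.norm_eq_abs, ← hsub i i.2]
      exact hTw.abs_vertex_sub_le hTx (fun i hi => (hbw i hi).1) (fun i hi => (hbx i hi).1)
        f.2 hC hle i.2
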